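/- arXiv:2104.07828 — 3 statements merged into one kernel-verified Lean document; each statement's English description precedes it below -/
import Mathlib

section
/- For all D0, D1 ≥ 1 and K ≥ 1 there exists a constant D = D(D0, D1, K) with the following property. Let r > 0 and let M be a nonempty finite set endowed with two metrics d0 and d1 such that |d0(x,y) − d1(x,y)| ≤ 2r for all x,y ∈ M, such that (M,d0) embeds into L1 with distortion at most D0 and (M,d1) embeds into L1 with distortion at most D1, and such that there exists a map ψ from M into an L1 space with min{d0(x,y), d1(x,y)} ≤ ‖ψ(x) − ψ(y)‖₁ ≤ K·min{d0(x,y), d1(x,y)} for all x,y ∈ M. Then the r-twisted union (M × {0,1}, d) of (M,d0) and (M,d1) embeds into L1 with distortion at most D. -/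
open MeasureTheory

/-- `d` is a metric on `M`. -/
def IsMetric {M : Type*} (d : M → M → ℝ) : Prop :=
  (∀ x, d x x = 0) ∧ (∀ x y, x ≠ y → 0 < d x y) ∧
  (∀ x y, d x y = d y x) ∧ (∀ x y z, d x z ≤ d x y + d y z)

/-- `(M, f)` embeds into (some) `L₁` with distortion at most `K`, in the
generalized sense allowing `f` to be an arbitrary nonnegative function. -/
def EmbedsL1 {M : Type*} (f : M → M → ℝ) (K : ℝ) : Prop :=
  ∃ (Ω : Type) (_ : MeasurableSpace Ω) (μ : Measure Ω) (Ψ : M → Lp ℝ 1 μ),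
    ∀ x y, f x y ≤ ‖Ψ x - Ψ y‖ ∧ ‖Ψ x - Ψ y‖ ≤ K * f x y

/-- The metric of the (generalized) twisted union of `(M, d0)` and `(M, d1)`
with joining function `r`, realized on `M × Bool` (`false` plays the role of
`0` and `true` the role of `1`). -/
noncomputable def twistedDist {M : Type*} (d0 d1 : M → M → ℝ) (r : M → ℝ) :
    M × Bool → M × Bool → ℝ
  | (x, false), (y, false) => d0 x y
  | (x, true),  (y, true)  => d1 x y
  | (x, false), (y, true)  => ⨅ z : M, d0 x z + d1 z y + r z
  | (x, true),  (y, false) => ⨅ z : M, d0 y z + d1 z x + r z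

/-- A finite-dimensional `ℓ₁` picture gives an `L₁` embedding. -/
lemma embedsL1_of_finite {X : Type*} {ι : Type} [Fintype ι] (f : X → X → ℝ) (K : ℝ)
    (g : X → ι → ℝ) (h : ∀ x y, f x y ≤ ∑ i, |g x i - g y i| ∧
      ∑ i, |g x i - g y i| ≤ K * f x y) : EmbedsL1 f K := by
  letI : MeasurableSpace ι := ⊤
  have hm : ∀ x, Integrable (g x) (Measure.count : Measure ι) := fun x => Integrable.of_finite
  refine ⟨ι, ⊤, Measure.count, fun x => (hm x).toL1 (g x), fun x y => ?_⟩
  have : ‖(hm x).toL1 (g x) - (hm y).toL1 (g y)‖ = ∑ i, |g x i - g y i| := by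
    rw [← Integrable.toL1_sub, L1.norm_of_fun_eq_integral_norm, integral_count]
    simp [Real.norm_eq_abs]
  rw [this]
  exact h x y

/-- The weight of the cut `S` for real values `a`. -/
noncomputable def cutW {M : Type*} [Fintype M] [DecidableEq M] (S : Finset M) (a : M → ℝ) : ℝ :=
  if h : (S ×ˢ Sᶜ).Nonempty then (S ×ˢ Sᶜ).inf' h (fun p => max (a p.1 - a p.2) 0) else 0

lemma cutW_nonneg {M : Type*} [Fintype M] [DecidableEq M] (S : Finset M) (a : M → ℝ) :
    0 ≤ cutW S a := by
  unfold cutW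
  split_ifs with h
  · exact (Finset.le_inf'_iff _ _).2 fun p _ => le_max_right _ _
  · exact le_rfl

lemma cutW_volume {M : Type*} [Fintype M] [DecidableEq M] (S : Finset M) (a : M → ℝ)
    (h : (S ×ˢ Sᶜ).Nonempty) :
    MeasurableSet {t : ℝ | ∀ x, t < a x ↔ x ∈ S} ∧
    volume {t : ℝ | ∀ x, t < a x ↔ x ∈ S} = ENNReal.ofReal (cutW S a) := by
  obtain ⟨h1, h2⟩ := Finset.nonempty_product.1 h
  obtain ⟨x0, hx0, hx⟩ := Finset.exists_min_image S a h1
  obtain ⟨y0, hy0, hy⟩ := Finset.exists_max_image Sᶜ a h2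
  have hs : {t : ℝ | ∀ x, t < a x ↔ x ∈ S} = Set.Ico (a y0) (a x0) := by
    ext t
    simp only [Set.mem_ofPred_eq, Set.mem_Ico]
    constructor
    · intro H
      refine ⟨?_, (H x0).2 hx0⟩
      by_contra hc
      exact (Finset.mem_compl.1 hy0) ((H y0).1 (not_le.1 hc))
    · rintro ⟨ha, hb⟩ x
      constructor
      · intro hlt
        by_contra hc
        have := hy x (Finset.mem_compl.2 hc)
        linarith
      · intro hxS
        have := hx x hxS
        linarith
  have hc : cutW S a = max (a x0 - a y0) 0 := by
    unfold cutW
    rw [dif_pos h]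
    apply le_antisymm
    · exact Finset.inf'_le (fun p : M × M => max (a p.1 - a p.2) 0)
        (Finset.mk_mem_product hx0 hy0)
    · refine (Finset.le_inf'_iff _ _).2 fun p hp => ?_
      obtain ⟨hp1, hp2⟩ := Finset.mem_product.1 hp
      exact max_le_max (sub_le_sub (hx _ hp1) (hy _ hp2)) le_rfl
  rw [hs, hc]
  refine ⟨measurableSet_Ico, ?_⟩
  rw [Real.volume_Ico]
  rcases le_total (a x0 - a y0) 0 with h0 | h0
  · rw [max_eq_right h0, ENNReal.ofReal_of_nonpos h0]; simp
  · rw [max_eq_left h0]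

lemma cut_decomp {M : Type*} [Fintype M] [DecidableEq M] (a : M → ℝ) (x y : M) :
    |a x - a y| = ∑ S : Finset M, if (x ∈ S ↔ y ∈ S) then 0 else cutW S a := by
  have key : ENNReal.ofReal |a x - a y| =
      ENNReal.ofReal (∑ S : Finset M, if (x ∈ S ↔ y ∈ S) then 0 else cutW S a) := by
    have hne : ∀ S : Finset M, ¬ (x ∈ S ↔ y ∈ S) → (S ×ˢ Sᶜ).Nonempty := by
      intro S hS
      by_cases hx : x ∈ S
      · exact ⟨(x, y), by simp; tauto⟩
      · exact ⟨(y, x), by simp; tauto⟩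
    have hU : Set.Ico (min (a x) (a y)) (max (a x) (a y)) =
        ⋃ S ∈ (Finset.univ.filter fun S : Finset M => ¬ (x ∈ S ↔ y ∈ S)),
          {t : ℝ | ∀ z, t < a z ↔ z ∈ S} := by
      ext t
      simp only [Set.mem_Ico, Finset.mem_filter, Finset.mem_univ, true_and, Set.mem_iUnion,
        Set.mem_ofPred_eq, exists_prop, min_le_iff, lt_max_iff]
      constructor
      · intro H
        refine ⟨Finset.univ.filter fun z => t < a z, ?_, by simp⟩
        simp only [Finset.mem_filter, Finset.mem_univ, true_and]
        simp only [← not_lt] at H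
        rcases H with ⟨h1 | h1, h2 | h2⟩ <;> tauto
      · rintro ⟨S, hS, H⟩
        rw [← H x, ← H y] at hS
        simp only [← not_lt]
        tauto
    have hvol : volume (Set.Ico (min (a x) (a y)) (max (a x) (a y))) =
        ENNReal.ofReal |a x - a y| := by
      rw [Real.volume_Ico, max_sub_min_eq_abs']
    rw [← hvol, hU, measure_biUnion_finset, ENNReal.ofReal_sum_of_nonneg, Finset.sum_filter]
    · refine Finset.sum_congr rfl fun S _ => ?_
      by_cases hS : (x ∈ S ↔ y ∈ S)
      · simp [hS]
      · rw [if_pos hS, if_neg hS, (cutW_volume S a (hne S hS)).2]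
    · intro S _
      split_ifs
      · exact le_rfl
      · exact cutW_nonneg _ _
    · intro S _ T _ hST
      refine Set.disjoint_left.2 fun t ht ht' => hST ?_
      ext z
      rw [← ht z, ← ht' z]
    · intro S hS
      exact (cutW_volume S a (hne S (Finset.mem_filter.1 hS).2)).1
  have h2 : 0 ≤ ∑ S : Finset M, if (x ∈ S ↔ y ∈ S) then 0 else cutW S a := by
    refine Finset.sum_nonneg fun S _ => ?_
    split_ifs
    · exact le_rfl
    · exact cutW_nonneg _ _
  exact (ENNReal.ofReal_eq_ofReal_iff (abs_nonneg _) h2).1 key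

lemma cutW_integrable {M : Type*} [Fintype M] [DecidableEq M] {Ω : Type*} [MeasurableSpace Ω]
    {μ : Measure Ω} (f : M → Ω → ℝ) (hf : ∀ x, Integrable (f x) μ) (S : Finset M) :
    Integrable (fun ω => cutW S (fun x => f x ω)) μ := by
  unfold cutW
  by_cases h : (S ×ˢ Sᶜ).Nonempty
  · simp only [dif_pos h]
    have := Finset.inf'_induction h
      (fun (p : M × M) (ω : Ω) => max (f p.1 ω - f p.2 ω) 0) (p := fun g => Integrable g μ)
      (fun a ha b hb => ha.inf hb)
      (fun p _ => ((hf p.1).sub (hf p.2)).sup (integrable_zero _ _ _))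
    convert this using 1
    ext ω
    rw [Finset.inf'_apply]
  · simp only [dif_neg h]
    exact integrable_zero _ _ _

/-- Cut-cone decomposition of finite `L₁` metrics. -/
lemma L1_cut {M : Type*} [Fintype M] [DecidableEq M] {Ω : Type*} [MeasurableSpace Ω]
    {μ : Measure Ω} (Ψ : M → Lp ℝ 1 μ) :
    ∃ l : Finset M → ℝ, (∀ S, 0 ≤ l S) ∧
      ∀ x y, ‖Ψ x - Ψ y‖ = ∑ S : Finset M, if (x ∈ S ↔ y ∈ S) then 0 else l S := by
  have hi : ∀ x, Integrable (Ψ x : Ω → ℝ) μ := fun x => L1.integrable_coeFn _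
  refine ⟨fun S => ∫ ω, cutW S (fun x => Ψ x ω) ∂μ,
    fun S => integral_nonneg fun ω => cutW_nonneg _ _, fun x y => ?_⟩
  have e1 : ‖Ψ x - Ψ y‖ = ∫ ω, |Ψ x ω - Ψ y ω| ∂μ := by
    rw [L1.norm_eq_integral_norm]
    refine integral_congr_ae ?_
    filter_upwards [Lp.coeFn_sub (Ψ x) (Ψ y)] with ω hω
    rw [hω]; rfl
  rw [e1]
  simp_rw [fun ω => cut_decomp (fun z => Ψ z ω) x y]
  rw [integral_finsetSum]
  · refine Finset.sum_congr rfl fun S _ => ?_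
    split_ifs <;> simp
  · intro S _
    split_ifs
    · exact integrable_zero _ _ _
    · exact cutW_integrable (fun z => (Ψ z : Ω → ℝ)) hi S

/-- Random sign realization of `1 - exp (-δ)` for a cut metric `δ`. -/
lemma cut_trunc {M : Type} [Fintype M] [DecidableEq M] (l : Finset M → ℝ) (hl : ∀ S, 0 ≤ l S) :
    ∃ g : M → (Finset M → Bool) → ℝ, (∀ x, ∑ e, |g x e| = 1) ∧
      ∀ x y, ∑ e, |g x e - g y e| =
        1 - Real.exp (-(∑ S : Finset M, if (x ∈ S ↔ y ∈ S) then 0 else l S)) := by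
  set w : Finset M → Bool → ℝ := fun S b =>
    if b then (1 - Real.exp (-l S)) / 2 else (1 + Real.exp (-l S)) / 2 with hw
  set s : M → Finset M → Bool → ℝ := fun x S b => if x ∈ S ∧ b = true then -1 else 1 with hs
  have hw0 : ∀ S b, 0 ≤ w S b := by
    intro S b
    have h1 : Real.exp (-l S) ≤ 1 := Real.exp_le_one_iff.2 (by linarith [hl S])
    have h2 := Real.exp_pos (-l S)
    simp only [hw]
    split_ifs <;> linarith
  have hW0 : ∀ e : Finset M → Bool, 0 ≤ ∏ S, w S (e S) :=
    fun e => Finset.prod_nonneg fun S _ => hw0 _ _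
  have hW1 : ∑ e : Finset M → Bool, ∏ S, w S (e S) = 1 := by
    rw [← Fintype.prod_sum]
    refine Finset.prod_eq_one fun S _ => ?_
    simp only [hw, Fintype.sum_bool]
    simp; ring
  have hsg : ∀ x (e : Finset M → Bool), (∏ S, s x S (e S)) = 1 ∨ (∏ S, s x S (e S)) = -1 := by
    intro x e
    refine Finset.prod_induction _ (fun t : ℝ => t = 1 ∨ t = -1) ?_ (Or.inl rfl) ?_
    · rintro a b (rfl | rfl) (rfl | rfl) <;> simp
    · intro S _
      simp only [hs]
      split_ifs <;> simp
  refine ⟨fun x e => (∏ S, w S (e S)) * ∏ S, s x S (e S), fun x => ?_, fun x y => ?_⟩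
  · rw [← hW1]
    refine Finset.sum_congr rfl fun e _ => ?_
    rw [abs_mul, abs_of_nonneg (hW0 e)]
    rcases hsg x e with h | h <;> rw [h] <;> simp
  · have e1 : ∀ e : Finset M → Bool, |(∏ S, w S (e S)) * ∏ S, s x S (e S) -
        (∏ S, w S (e S)) * ∏ S, s y S (e S)| =
        (∏ S, w S (e S)) - ∏ S, (w S (e S) * (s x S (e S) * s y S (e S))) := by
      intro e
      rw [← mul_sub, abs_mul, abs_of_nonneg (hW0 e), Finset.prod_mul_distrib,
        Finset.prod_mul_distrib]
      rcases hsg x e with h | h <;> rcases hsg y e with h' | h' <;> rw [h, h'] <;> norm_num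
      all_goals ring
    rw [Finset.sum_congr rfl fun e _ => e1 e, Finset.sum_sub_distrib, hW1]
    congr 1
    rw [← Fintype.prod_sum (fun S b => w S b * (s x S b * s y S b)), ← Finset.sum_neg_distrib,
      Real.exp_sum]
    refine Finset.prod_congr rfl fun S _ => ?_
    simp only [hw, hs, Fintype.sum_bool]
    by_cases hx : x ∈ S <;> by_cases hy : y ∈ S <;> simp [hx, hy] <;> ring

/-- Truncation of an `L₁` metric at scale `r`. -/
lemma trunc {M : Type} [Fintype M] [DecidableEq M] (d : M → M → ℝ) (D r : ℝ) (hr : 0 < r)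
    (hd : ∀ x y, 0 ≤ d x y) (h : EmbedsL1 d D) :
    ∃ g : M → (Finset M → Bool) → ℝ, (∀ x, ∑ e, |g x e| = r) ∧
      ∀ x y, min (d x y) r ≤ 2 * ∑ e, |g x e - g y e| ∧ ∑ e, |g x e - g y e| ≤ D * d x y := by
  obtain ⟨Ω, _, μ, Ψ, hΨ⟩ := h
  obtain ⟨l, hl, hl'⟩ := L1_cut Ψ
  obtain ⟨g, hg, hg'⟩ := cut_trunc (fun S => l S / r) (fun S => div_nonneg (hl S) hr.le)
  refine ⟨fun x e => r * g x e, fun x => ?_, fun x y => ?_⟩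
  · simp_rw [abs_mul, ← Finset.mul_sum, hg, abs_of_pos hr, mul_one]
  · have e1 : ∑ e, |r * g x e - r * g y e| = r * (1 - Real.exp (-(‖Ψ x - Ψ y‖ / r))) := by
      simp_rw [← mul_sub, abs_mul, ← Finset.mul_sum, hg', abs_of_pos hr, hl', Finset.sum_div]
      congr! 5
      split_ifs <;> simp
    rw [e1]
    obtain ⟨h1, h2⟩ := hΨ x y
    have hd0 := hd x y
    set n := ‖Ψ x - Ψ y‖
    have hn : 0 ≤ n := norm_nonneg _
    constructor
    · have hE : Real.exp (-(n / r)) ≤ r / (r + n) := by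
        rw [Real.exp_neg, inv_le_comm₀ (Real.exp_pos _) (by positivity), inv_div]
        have := Real.add_one_le_exp (n / r)
        have e : (r + n) / r = n / r + 1 := by field_simp; ring
        rw [e]; exact this
      have hmn : min (d x y) r ≤ 2 * (r * (1 - r / (r + n))) := by
        have e : r * (1 - r / (r + n)) = r * n / (r + n) := by field_simp; ring
        rw [e, mul_div_assoc', le_div_iff₀ (by positivity)]
        rcases le_total n r with hc | hc
        · have : min (d x y) r ≤ n := (min_le_left _ _).trans h1
          nlinarith
        · have : min (d x y) r ≤ r := min_le_right _ _
          nlinarith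
      have := mul_le_mul_of_nonneg_left hE hr.le
      nlinarith
    · have := Real.add_one_le_exp (-(n / r))
      have h3 : r * (1 - Real.exp (-(n / r))) ≤ r * (n / r) :=
        mul_le_mul_of_nonneg_left (by linarith) hr.le
      rw [mul_div_cancel₀ _ hr.ne'] at h3
      linarith

/-- Theorem 4.1: the `r`-twisted union of two `L₁`-embeddable metrics whose
minimum is also `L₁`-embeddable embeds into `L₁` with distortion bounded by a
constant depending only on `D0`, `D1`, `K`. -/
theorem twisted_union_embeds_L1_of_min_embeds (D0 D1 K : ℝ)
    (hD0 : 1 ≤ D0) (hD1 : 1 ≤ D1) (hK : 1 ≤ K) :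
    ∃ D : ℝ,
      ∀ (M : Type) [Fintype M] [Nonempty M]
        (d0 d1 : M → M → ℝ) (r : ℝ), 0 < r →
        IsMetric d0 → IsMetric d1 →
        (∀ x y, |d0 x y - d1 x y| ≤ 2 * r) →
        EmbedsL1 d0 D0 → EmbedsL1 d1 D1 →
        EmbedsL1 (fun x y => min (d0 x y) (d1 x y)) K →
        EmbedsL1 (twistedDist d0 d1 (fun _ => r)) D := by
  classical
  refine ⟨8 * (K + D0 + D1 + 1), ?_⟩
  intro M _ _ d0 d1 r hr h0 h1 hdiff hE0 hE1 hEm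
  have nn : ∀ d : M → M → ℝ, IsMetric d → ∀ x y, 0 ≤ d x y := by
    intro d hd x y
    by_cases h : x = y
    · rw [h, hd.1]
    · exact (hd.2.1 x y h).le
  have n0 := nn d0 h0
  have n1 := nn d1 h1
  obtain ⟨g0, hg0, hg0'⟩ := trunc d0 D0 r hr n0 hE0
  obtain ⟨g1, hg1, hg1'⟩ := trunc d1 D1 r hr n1 hE1
  obtain ⟨Ω, _, μ, Ψ, hΨ⟩ := hEm
  obtain ⟨l, hl, hl'⟩ := L1_cut Ψ
  have hcut : ∀ x y : M, ∑ S : Finset M, |4 * (if x ∈ S then l S else 0) -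
      4 * (if y ∈ S then l S else 0)| = 4 * ‖Ψ x - Ψ y‖ := by
    intro x y
    rw [hl', Finset.mul_sum]
    refine Finset.sum_congr rfl fun S _ => ?_
    by_cases hx : x ∈ S <;> by_cases hy : y ∈ S <;> simp [hx, hy, abs_of_nonneg (hl S)]
  have hsc : ∀ (u v : (Finset M → Bool) → ℝ), ∑ e, |4 * u e - 4 * v e| =
      4 * ∑ e, |u e - v e| := by
    intro u v
    rw [Finset.mul_sum]
    refine Finset.sum_congr rfl fun e _ => ?_
    rw [← mul_sub, abs_mul]; norm_num
  have hsc1 : ∀ (u : (Finset M → Bool) → ℝ), ∑ e, |4 * u e| = 4 * ∑ e, |u e| := by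
    intro u
    rw [Finset.mul_sum]
    refine Finset.sum_congr rfl fun e _ => ?_
    rw [abs_mul]; norm_num
  -- same layer estimate
  have same : ∀ (a b m p t D' : ℝ), 0 ≤ a → 0 ≤ b → |a - b| ≤ 2 * r → m = min a b → m ≤ p →
      p ≤ K * m → min a r ≤ 2 * t → t ≤ D' * a → D' ≤ D0 + D1 →
      a ≤ 4 * p + 4 * t ∧ 4 * p + 4 * t ≤ 8 * (K + D0 + D1 + 1) * a := by
    intro a b m p t D' ha hb hab hm hp hp' ht ht' hD
    have hma : m ≤ a := hm ▸ min_le_left _ _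
    have hm0 : 0 ≤ m := hm ▸ le_min ha hb
    have hm2 : a - 2 * r ≤ m := by
      rw [hm]; exact le_min (by linarith) (by linarith [(abs_le.1 hab).2])
    constructor
    · rcases le_total a r with h | h
      · rw [min_eq_left h] at ht; linarith
      · rw [min_eq_right h] at ht; linarith
    · have e1 : K * m ≤ K * a := mul_le_mul_of_nonneg_left hma (by linarith)
      have e2 : D' * a ≤ (D0 + D1) * a := mul_le_mul_of_nonneg_right hD ha
      nlinarith
  -- cross layer estimate
  have cross : ∀ x y : M,
      (⨅ z : M, d0 x z + d1 z y + r) ≤ 4 * ‖Ψ x - Ψ y‖ + 4 * r + 4 * r ∧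
      4 * ‖Ψ x - Ψ y‖ + 4 * r + 4 * r ≤
        8 * (K + D0 + D1 + 1) * ⨅ z : M, d0 x z + d1 z y + r := by
    intro x y
    obtain ⟨hp, hp'⟩ := hΨ x y
    have hbdd : BddBelow (Set.range fun z : M => d0 x z + d1 z y + r) :=
      (Set.finite_range _).bddBelow
    have c1 : (⨅ z : M, d0 x z + d1 z y + r) ≤ d0 x y + r := by
      have := ciInf_le hbdd y
      simpa [h1.1] using this
    have c2 : (⨅ z : M, d0 x z + d1 z y + r) ≤ d1 x y + r := by
      have := ciInf_le hbdd x
      simpa [h0.1] using this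
    have c3 : r ≤ ⨅ z : M, d0 x z + d1 z y + r :=
      le_ciInf fun z => by linarith [n0 x z, n1 z y]
    have c4 : d0 x y - r ≤ ⨅ z : M, d0 x z + d1 z y + r :=
      le_ciInf fun z => by linarith [h0.2.2.2 x z y, (abs_le.1 (hdiff z y)).2]
    set c := ⨅ z : M, d0 x z + d1 z y + r
    have c5 : c - r ≤ min (d0 x y) (d1 x y) := le_min (by linarith) (by linarith)
    have c6 : min (d0 x y) (d1 x y) ≤ 2 * c := (min_le_left _ _).trans (by linarith)
    simp only at hp hp'
    constructor
    · have := norm_nonneg (Ψ x - Ψ y)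
      linarith
    · have e1 : K * min (d0 x y) (d1 x y) ≤ K * (2 * c) :=
        mul_le_mul_of_nonneg_left c6 (by linarith)
      have e2 : 0 ≤ (D0 + D1) * c := mul_nonneg (by linarith) (by linarith)
      nlinarith
  refine embedsL1_of_finite (ι := Finset M ⊕ ((Finset M → Bool) ⊕ (Finset M → Bool))) _ _
    (fun q i => match i with
      | Sum.inl S => 4 * (if q.1 ∈ S then l S else 0)
      | Sum.inr (Sum.inl e) => if q.2 then 0 else 4 * g0 q.1 e
      | Sum.inr (Sum.inr e) => if q.2 then 4 * g1 q.1 e else 0) ?_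
  rintro ⟨x, b⟩ ⟨y, b'⟩
  simp only [Fintype.sum_sum_type, hcut]
  have hΨs : ‖Ψ x - Ψ y‖ = ‖Ψ y - Ψ x‖ := norm_sub_rev _ _
  cases b <;> cases b'
  · simp only [twistedDist, Bool.false_eq_true, if_false, hsc, sub_self, abs_zero,
      Finset.sum_const_zero, add_zero]
    exact same _ (d1 x y) _ _ _ D0 (n0 x y) (n1 x y) (hdiff x y) rfl (hΨ x y).1 (hΨ x y).2
      (hg0' x y).1 (hg0' x y).2 (by linarith)
  · simp only [twistedDist, Bool.false_eq_true, if_false, if_true, sub_zero, zero_sub, abs_neg,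
      hsc1, hg0, hg1, ← add_assoc]
    exact cross x y
  · simp only [twistedDist, Bool.false_eq_true, if_false, if_true, sub_zero, zero_sub, abs_neg,
      hsc1, hg0, hg1, ← add_assoc, hΨs]
    exact cross y x
  · simp only [twistedDist, if_true, hsc, sub_self, abs_zero,
      Finset.sum_const_zero, zero_add]
    exact same _ (d0 x y) _ _ _ D1 (n1 x y) (n0 x y) (by rw [abs_sub_comm]; exact hdiff x y)
      (min_comm _ _) (hΨ x y).1 (hΨ x y).2 (hg1' x y).1 (hg1' x y).2 (by linarith)
end

section
/- For all constants C1, C2 ≥ 1 and C3, C4 > 0 there exists a constant D = D(C1, C2, C3, C4) with the following property. Let M be a nonempty finite set endowed with two metrics d0 and d1 and let r : M → (0,∞) satisfy, for all x,y ∈ M, |d0(x,y) − d1(x,y)| ≤ r(x) + r(y) and |r(x) − r(y)| ≤ d0(x,y) + d1(x,y). Suppose there exists a function f : M × M → [0,∞) such that c1(M, d1) ≤ C1, c1(M, min{f(x,y), r(x) + r(y)}) ≤ C2, and (1/C3)·d0(x,y) ≤ d1(x,y) + f(x,y) ≤ C4·d0(x,y) for all x,y ∈ M. Then the generalized twisted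 union (M × {0,1}, d) of (M,d0) and (M,d1) with joining function r embeds into L1 with distortion at most D. -/
open MeasureTheory

lemma l1_sum {I Ω Ω' : Type} [MeasurableSpace Ω] [MeasurableSpace Ω']
    (μ : Measure Ω) (ν : Measure Ω') (Ψ : I → Lp ℝ 1 μ) (Φ : I → Lp ℝ 1 ν) :
    ∃ (X : Type) (_ : MeasurableSpace X) (m : Measure X) (Θ : I → Lp ℝ 1 m),
      ∀ i j, ‖Θ i - Θ j‖ = ‖Ψ i - Ψ j‖ + ‖Φ i - Φ j‖ := by
  have el : MeasurableEmbedding (Sum.inl : Ω → Ω ⊕ Ω') :=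
    ⟨Sum.inl_injective, measurable_inl, fun {s} hs => hs.inl_image⟩
  have er : MeasurableEmbedding (Sum.inr : Ω' → Ω ⊕ Ω') :=
    ⟨Sum.inr_injective, measurable_inr, fun {s} hs => measurableSet_inr_image.2 hs⟩
  have hint : ∀ i, Integrable (Sum.elim (Ψ i : Ω → ℝ) (Φ i : Ω' → ℝ))
      (μ.map Sum.inl + ν.map Sum.inr) := by
    intro i
    rw [integrable_add_measure, el.integrable_map_iff, er.integrable_map_iff]
    exact ⟨L1.integrable_coeFn (Ψ i), L1.integrable_coeFn (Φ i)⟩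
  refine ⟨Ω ⊕ Ω', inferInstance, μ.map Sum.inl + ν.map Sum.inr, fun i => (hint i).toL1 _, ?_⟩
  intro i j
  have hd := (hint i).sub (hint j)
  have hn := hd.norm
  rw [integrable_add_measure] at hn
  rw [← Integrable.toL1_sub, L1.norm_of_fun_eq_integral_norm, integral_add_measure hn.1 hn.2,
    el.integral_map, er.integral_map, L1.norm_eq_integral_norm, L1.norm_eq_integral_norm]
  congr 1
  · apply integral_congr_ae
    filter_upwards [Lp.coeFn_sub (Ψ i) (Ψ j)] with a ha
    rw [ha]; rfl
  · apply integral_congr_ae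
    filter_upwards [Lp.coeFn_sub (Φ i) (Φ j)] with a ha
    rw [ha]; rfl

lemma l1_real {I : Type} (u : I → ℝ) :
    ∃ (X : Type) (_ : MeasurableSpace X) (m : Measure X) (Θ : I → Lp ℝ 1 m),
      ∀ i j, ‖Θ i - Θ j‖ = |u i - u j| := by
  have hint : ∀ i, Integrable (fun _ : Unit => u i) (Measure.dirac ()) :=
    fun i => integrable_const _
  refine ⟨Unit, inferInstance, Measure.dirac (), fun i => (hint i).toL1 _, ?_⟩
  intro i j
  rw [← Integrable.toL1_sub, L1.norm_of_fun_eq_integral_norm]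
  simp

/-- Theorem 5.2: `L₁`-embeddability of generalized twisted unions when
`d0 ≍ d1 + f` for some `L₁`-embeddable (after truncation) function `f`. -/
theorem generalized_twisted_union_embeds_L1_comparable
    (C1 C2 : ℝ) (hC1 : 1 ≤ C1) (hC2 : 1 ≤ C2)
    (C3 C4 : ℝ) (hC3 : 0 < C3) (hC4 : 0 < C4) :
    ∃ D : ℝ,
      ∀ (M : Type) [Fintype M] [Nonempty M]
        (d0 d1 : M → M → ℝ) (r : M → ℝ),
        (∀ x, 0 < r x) →
        IsMetric d0 → IsMetric d1 →
        (∀ x y, |d0 x y - d1 x y| ≤ r x + r y) →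
        (∀ x y, |r x - r y| ≤ d0 x y + d1 x y) →
        ∀ (f : M → M → ℝ),
          (∀ x y, 0 ≤ f x y) →
          EmbedsL1 d1 C1 →
          EmbedsL1 (fun x y => min (f x y) (r x + r y)) C2 →
          (∀ x y, (1 / C3) * d0 x y ≤ d1 x y + f x y ∧
                  d1 x y + f x y ≤ C4 * d0 x y) →
          EmbedsL1 (twistedDist d0 d1 r) D := by
  refine ⟨(1 + C3) * ((1 + C4) * (C1 + 2 * C2 + 1)), ?_⟩
  intro M _ _ d0 d1 r hr h0 h1 hd hrd f hf ⟨Ω, _, μ, Ψ, hΨ⟩ ⟨Ω', _, ν, Φ, hΦ⟩ hcmp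
  obtain ⟨h00, -, h0s, h0t⟩ := h0
  obtain ⟨h10, -, h1s, h1t⟩ := h1
  have p0 : ∀ x y, 0 ≤ d0 x y := fun x y => by
    have := h0t x y x; rw [h00, h0s y x] at this; linarith
  have p1 : ∀ x y, 0 ≤ d1 x y := fun x y => by
    have := h1t x y x; rw [h10, h1s y x] at this; linarith
  obtain ⟨s, hs⟩ := Finite.exists_min r
  obtain ⟨X, _, m, Θ, hΘ⟩ := l1_sum μ ν (fun p : M × Bool => Ψ p.1)
    (fun p : M × Bool => if p.2 then 0 else Φ p.1 - Φ s)
  obtain ⟨Y, _, mR, R, hR⟩ := l1_real (fun p : M × Bool => if p.2 then 0 else r p.1)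
  obtain ⟨Z, _, mT, T, hT⟩ := l1_sum m mR Θ R
  have hB : ∀ x, ‖Φ x - Φ s‖ ≤ 2 * C2 * r x := fun x => by
    have a := (hΦ x s).2
    have b : min (f x s) (r x + r s) ≤ 2 * r x := (min_le_right _ _).trans (by linarith [hs x])
    nlinarith
  have hd1 : ∀ x y, d1 x y ≤ C4 * d0 x y := fun x y => by linarith [(hcmp x y).2, hf x y]
  have crossL : ∀ x y, (⨅ z : M, d0 x z + d1 z y + r z) ≤ d1 x y + r x := fun x y => by
    have := ciInf_le (Set.finite_range (fun z : M => d0 x z + d1 z y + r z)).bddBelow x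
    simpa [h00] using this
  have crossU : ∀ x y, C1 * d1 x y + (2 * C2 + 1) * r x ≤
      ((1 + C4) * (C1 + 2 * C2 + 1)) * (⨅ z : M, d0 x z + d1 z y + r z) := fun x y => by
    obtain ⟨z, hz⟩ := exists_eq_ciInf_of_finite (f := fun z : M => d0 x z + d1 z y + r z)
    rw [← hz]
    have a1 : d1 x y ≤ (1 + C4) * (d0 x z + d1 z y + r z) := by
      have := hd1 x z
      have := h1t x z y
      nlinarith [p0 x z, mul_nonneg hC4.le (p1 z y), mul_nonneg hC4.le (hr z).le, hr z]
    have a2 : r x ≤ (1 + C4) * (d0 x z + d1 z y + r z) := by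
      have := hd1 x z
      have := (abs_le.1 (hrd x z)).2
      nlinarith [p0 x z, mul_nonneg hC4.le (p1 z y), mul_nonneg hC4.le (hr z).le, hr z, p1 z y]
    have b1 := mul_le_mul_of_nonneg_left a1 (by linarith : 0 ≤ C1)
    have b2 := mul_le_mul_of_nonneg_left a2 (by linarith : 0 ≤ 2 * C2 + 1)
    linarith
  have cross : ∀ x y, (⨅ z : M, d0 x z + d1 z y + r z) ≤
        (1 + C3) * (‖Ψ x - Ψ y‖ + ‖Φ x - Φ s‖ + r x) ∧
      (1 + C3) * (‖Ψ x - Ψ y‖ + ‖Φ x - Φ s‖ + r x) ≤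
        (1 + C3) * ((1 + C4) * (C1 + 2 * C2 + 1)) * (⨅ z : M, d0 x z + d1 z y + r z) := by
    intro x y
    constructor
    · have := crossL x y
      have := (hΨ x y).1
      have h3 : 0 ≤ ‖Ψ x - Ψ y‖ + ‖Φ x - Φ s‖ + r x := by linarith [norm_nonneg (Ψ x - Ψ y), norm_nonneg (Φ x - Φ s), hr x]
      nlinarith [mul_nonneg hC3.le h3, norm_nonneg (Φ x - Φ s)]
    · rw [mul_assoc]
      apply mul_le_mul_of_nonneg_left _ (by linarith)
      linarith [crossU x y, hB x, (hΨ x y).2]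
  refine ⟨Z, _, mT, fun p => (1 + C3) • T p, ?_⟩
  have hN : ∀ p q, ‖(1 + C3) • T p - (1 + C3) • T q‖ = (1 + C3) * ‖T p - T q‖ := fun p q => by
    rw [← smul_sub, norm_smul, Real.norm_of_nonneg (by linarith)]
  rintro ⟨x, _ | _⟩ ⟨y, _ | _⟩ <;> simp only [hN, hT, hΘ, hR, twistedDist] <;>
    simp only [if_true, if_false, Bool.false_eq_true, sub_zero, zero_sub, norm_neg, abs_neg,
      sub_self, norm_zero, abs_zero, add_zero, sub_sub_sub_cancel_right]
  · have a := hΨ x y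
    have b := hΦ x y
    have c := hrd x y
    have e := (abs_le.1 (hd x y)).2
    have g := hd1 x y
    have k := hcmp x y
    have k1 : d0 x y ≤ C3 * (d1 x y + f x y) := by
      have := mul_le_mul_of_nonneg_left k.1 hC3.le
      rwa [← mul_assoc, mul_one_div_cancel hC3.ne', one_mul] at this
    have hρ : d0 x y ≤ (1 + C3) * (d1 x y + min (f x y) (r x + r y)) := by
      rcases le_total (f x y) (r x + r y) with h | h
      · rw [min_eq_left h]; linarith [p1 x y, hf x y]
      · rw [min_eq_right h]
        linarith [mul_nonneg hC3.le (p1 x y), mul_nonneg hC3.le (hr x).le, mul_nonneg hC3.le (hr y).le]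
    have hρ2 : min (f x y) (r x + r y) ≤ C4 * d0 x y :=
      (min_le_left _ _).trans (by linarith [p1 x y])
    constructor
    · refine hρ.trans (mul_le_mul_of_nonneg_left ?_ (by linarith))
      linarith [a.1, b.1, abs_nonneg (r x - r y)]
    · rw [mul_assoc]
      apply mul_le_mul_of_nonneg_left _ (by linarith)
      have b1 := mul_le_mul_of_nonneg_left g (by linarith : 0 ≤ C1)
      have b2 := mul_le_mul_of_nonneg_left hρ2 (by linarith : 0 ≤ C2)
      have q := p0 x y
      have q1 : 0 ≤ C1 * d0 x y := mul_nonneg (by linarith) q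
      have q2 : 0 ≤ C2 * d0 x y := mul_nonneg (by linarith) q
      have q3 : 0 ≤ C2 * (C4 * d0 x y) := mul_nonneg (by linarith) (mul_nonneg hC4.le q)
      linarith [a.2, b.2]
  · rw [abs_of_pos (hr x)]
    exact cross x y
  · rw [abs_of_pos (hr y), norm_sub_rev (Ψ x)]
    exact cross y x
  · have a := hΨ x y
    have q := p1 x y
    constructor
    · nlinarith [a.1, mul_nonneg hC3.le (norm_nonneg (Ψ x - Ψ y))]
    · rw [mul_assoc]
      apply mul_le_mul_of_nonneg_left _ (by linarith)
      refine a.2.trans (mul_le_mul_of_nonneg_right ?_ q)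
      nlinarith
end

section
/- Let X be the disjoint union of two copies of ℕ, with points denoted u_i (i ∈ ℕ) and b_j (j ∈ ℕ), equipped with the metric d defined by: d(u_i, u_j) = 2 for i ≠ j; d(b_i, b_j) = 2 for i ≠ j; d(u_i, b_j) = 1 if j ≥ i and d(u_i, b_j) = 3 if j < i. Then for every map F from X into an L1 space and all constants C1, C2 > 0 such that C1·d(p,q) ≤ ‖F(p) − F(q)‖₁ ≤ C2·d(p,q) for all p,q ∈ X, one has C2/C1 ≥ 3; that is, every bilipschitz embedding of X into L1 has distortion at least 3. -/
open MeasureTheory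

/-- The metric on the disjoint union of two copies of `ℕ` from
Example 6.5: `u i` is represented by `Sum.inl i` and `b j` by `Sum.inr j`;
`d(uᵢ,uⱼ) = d(bᵢ,bⱼ) = 2` for `i ≠ j`, `d(uᵢ,bⱼ) = 1` if `j ≥ i` and `= 3`
otherwise. -/
noncomputable def exampleDist : ℕ ⊕ ℕ → ℕ ⊕ ℕ → ℝ
  | Sum.inl i, Sum.inl j => if i = j then 0 else 2
  | Sum.inr i, Sum.inr j => if i = j then 0 else 2
  | Sum.inl i, Sum.inr j => if i ≤ j then 1 else 3
  | Sum.inr j, Sum.inl i => if i ≤ j then 1 else 3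

open Filter Topology in
/-- Weak compactness of balls along an ultrafilter. -/
theorem aux_weak_limit {H : Type*} [NormedAddCommGroup H] [InnerProductSpace ℝ H]
    [CompleteSpace H] (U : Ultrafilter ℕ) (a : ℕ → H) (R : ℝ) (hR : ∀ i, ‖a i‖ ≤ R) :
    ∃ x : H, ∀ y : H, Tendsto (fun i => inner ℝ (a i) y) U (𝓝 (inner ℝ x y)) := by
  let g : ℕ → WeakDual ℝ H := fun i => StrongDual.toWeakDual (InnerProductSpace.toDual ℝ H (a i))
  have hK := WeakDual.isCompact_closedBall (𝕜 := ℝ) (E := H) 0 R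
  obtain ⟨ψ, -, hψ⟩ := hK.ultrafilter_le_nhds (U.map g) (by
    simp only [Ultrafilter.coe_map, le_principal_iff, Filter.mem_map]
    apply Filter.univ_mem'
    intro i
    simp only [Set.mem_preimage, g]
    rw [Metric.mem_closedBall, dist_zero_right]
    show ‖InnerProductSpace.toDual ℝ H (a i)‖ ≤ R
    rw [LinearIsometryEquiv.norm_map]
    exact hR i)
  refine ⟨(InnerProductSpace.toDual ℝ H).symm (WeakDual.toStrongDual ψ), fun y => ?_⟩
  rw [InnerProductSpace.toDual_symm_apply]
  have h1 : Tendsto g U (𝓝 ψ) := hψ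
  exact ((WeakDual.eval_continuous y).tendsto ψ).comp h1

open Filter Topology in
theorem aux_real_limit (U : Ultrafilter ℕ) (a : ℕ → ℝ) (R : ℝ) (hR : ∀ i, |a i| ≤ R) :
    ∃ x : ℝ, Tendsto a U (𝓝 x) := by
  obtain ⟨x, -, hx⟩ := (isCompact_Icc (a := -R) (b := R)).ultrafilter_le_nhds (U.map a) (by
    simp only [Ultrafilter.coe_map, le_principal_iff, Filter.mem_map]
    exact Filter.univ_mem' fun i => abs_le.1 (hR i))
  exact ⟨x, hx⟩

open Filter Topology in
/-- Stability of Hilbert space, in the form we need. -/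
theorem aux_stable {H : Type*} [NormedAddCommGroup H] [InnerProductSpace ℝ H]
    [CompleteSpace H] (a b : ℕ → H) (R : ℝ) (ha : ∀ i, ‖a i‖ ≤ R) (hb : ∀ i, ‖b i‖ ≤ R)
    (c₁ c₂ : ℝ) (h1 : ∀ i j, i ≤ j → ‖a i - b j‖ ^ 2 ≤ c₁)
    (h2 : ∀ i j, j < i → c₂ ≤ ‖a i - b j‖ ^ 2) : c₂ ≤ c₁ := by
  let U : Ultrafilter ℕ := hyperfilter ℕ
  have hU : (U : Filter ℕ) ≤ atTop := by
    rw [← Nat.cofinite_eq_atTop]; exact hyperfilter_le_cofinite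
  obtain ⟨x, hx⟩ := aux_weak_limit U a R ha
  obtain ⟨y, hy⟩ := aux_weak_limit U b R hb
  have hsq : ∀ z : H, ‖z‖ ≤ R → |‖z‖ ^ 2| ≤ R ^ 2 := fun z hz => by
    rw [abs_of_nonneg (by positivity)]
    exact pow_le_pow_left₀ (norm_nonneg z) hz 2
  obtain ⟨α, hα⟩ := aux_real_limit U (fun i => ‖a i‖ ^ 2) (R ^ 2) (fun i => hsq _ (ha i))
  obtain ⟨β, hβ⟩ := aux_real_limit U (fun i => ‖b i‖ ^ 2) (R ^ 2) (fun i => hsq _ (hb i))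
  have hx' : ∀ j, c₂ ≤ α - 2 * inner ℝ x (b j) + ‖b j‖ ^ 2 := fun j => by
    have ht := (hα.sub ((hx (b j)).const_mul 2)).add_const (‖b j‖ ^ 2)
    refine ge_of_tendsto ht ?_
    filter_upwards [hU (eventually_gt_atTop j)] with i hi
    have := h2 i j hi
    rwa [norm_sub_sq_real] at this
  have hy' : ∀ i, ‖a i‖ ^ 2 - 2 * inner ℝ y (a i) + β ≤ c₁ := fun i => by
    have ht := (((hy (a i)).const_mul 2).const_sub (‖a i‖ ^ 2)).add hβ
    refine le_of_tendsto ht ?_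
    filter_upwards [hU (eventually_ge_atTop i)] with j hj
    have := h1 i j hj
    rwa [norm_sub_sq_real, real_inner_comm] at this
  have e1 : c₂ ≤ α - 2 * inner ℝ y x + β := by
    have ht := (((hy x).const_mul 2).const_sub α).add hβ
    refine ge_of_tendsto ht (Eventually.of_forall fun j => ?_)
    have := hx' j
    rwa [real_inner_comm] at this
  have e2 : α - 2 * inner ℝ x y + β ≤ c₁ := by
    have ht := (hα.sub ((hx y).const_mul 2)).add_const β
    refine le_of_tendsto ht (Eventually.of_forall fun i => ?_)
    have := hy' i
    rwa [real_inner_comm] at this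
  rw [real_inner_comm] at e2
  linarith

theorem aux_inter (x y : ℝ) :
    (volume : Measure ℝ).real (Set.uIoc 0 x ∩ Set.uIoc 0 y) = (|x| + |y| - |x - y|) / 2 := by
  rcases le_total 0 x with hx | hx <;> rcases le_total 0 y with hy | hy
  · rw [Set.uIoc_of_le hx, Set.uIoc_of_le hy, Set.Ioc_inter_Ioc, Real.volume_real_Ioc]
    rcases le_total x y with h | h
    · rw [abs_of_nonneg hx, abs_of_nonneg hy, abs_of_nonpos (by linarith)]
      simp [h, hx] <;> ring
    · rw [abs_of_nonneg hx, abs_of_nonneg hy, abs_of_nonneg (by linarith)]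
      simp [h, hy] <;> ring
  · rw [Set.uIoc_of_le hx, Set.uIoc_of_ge hy, Set.Ioc_inter_Ioc, Real.volume_real_Ioc,
      abs_of_nonneg hx, abs_of_nonpos hy, abs_of_nonneg (by linarith)]
    simp [hx, hy] <;> ring
  · rw [Set.uIoc_of_ge hx, Set.uIoc_of_le hy, Set.Ioc_inter_Ioc, Real.volume_real_Ioc,
      abs_of_nonpos hx, abs_of_nonneg hy, abs_of_nonpos (by linarith)]
    simp [hx, hy] <;> ring
  · rw [Set.uIoc_of_ge hx, Set.uIoc_of_ge hy, Set.Ioc_inter_Ioc, Real.volume_real_Ioc]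
    rcases le_total x y with h | h
    · rw [abs_of_nonpos hx, abs_of_nonpos hy, abs_of_nonpos (by linarith)]
      simp [h, hy] <;> ring
    · rw [abs_of_nonpos hx, abs_of_nonpos hy, abs_of_nonneg (by linarith)]
      simp [h, hx] <;> ring

theorem aux_scalar {ι : Type*} (s : Finset ι) (c x : ι → ℝ) :
    0 ≤ ∑ i ∈ s, ∑ j ∈ s, c i * c j * ((|x i| + |x j| - |x i - x j|) / 2) := by
  have hm : ∀ t : ℝ, MeasurableSet (Set.uIoc 0 t) := fun t => measurableSet_uIoc
  have hf : ∀ t : ℝ, (volume : Measure ℝ) (Set.uIoc 0 t) ≠ ⊤ := fun t => by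
    rw [Set.uIoc]; exact measure_Ioc_lt_top.ne
  let φ : ℝ → Lp ℝ 2 (volume : Measure ℝ) := fun t => indicatorConstLp 2 (hm t) (hf t) (1 : ℝ)
  have key : ∀ u v : ℝ, inner ℝ (φ u) (φ v) = (|u| + |v| - |u - v|) / 2 := fun u v => by
    rw [← aux_inter]
    exact L2.real_inner_indicatorConstLp_one_indicatorConstLp_one _ _ _ _
  have h0 : 0 ≤ inner ℝ (∑ i ∈ s, c i • φ (x i)) (∑ i ∈ s, c i • φ (x i)) :=
    real_inner_self_nonneg
  convert h0 using 1
  rw [sum_inner]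
  refine Finset.sum_congr rfl fun i _ => ?_
  rw [inner_sum]
  refine Finset.sum_congr rfl fun j _ => ?_
  rw [real_inner_smul_left, real_inner_smul_right, key]
  ring

theorem aux_L1 {Ω : Type*} [MeasurableSpace Ω] (μ : Measure Ω) {ι : Type*}
    (F : ι → Lp ℝ 1 μ) (s : Finset ι) (c : ι → ℝ) :
    0 ≤ ∑ i ∈ s, ∑ j ∈ s, c i * c j * ((‖F i‖ + ‖F j‖ - ‖F i - F j‖) / 2) := by
  have hint : ∀ f : Lp ℝ 1 μ, Integrable (fun ω => |f ω|) μ := fun f =>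
    (L1.integrable_coeFn f).abs
  have hd : ∀ i j, Integrable (fun ω => |F i ω - F j ω|) μ := fun i j =>
    ((L1.integrable_coeFn (F i)).sub (L1.integrable_coeFn (F j))).abs
  have hn : ∀ f : Lp ℝ 1 μ, ‖f‖ = ∫ ω, |f ω| ∂μ := fun f => by
    rw [L1.norm_eq_integral_norm]; rfl
  have hnd : ∀ i j, ‖F i - F j‖ = ∫ ω, |F i ω - F j ω| ∂μ := fun i j => by
    rw [hn]
    apply integral_congr_ae
    filter_upwards [Lp.coeFn_sub (F i) (F j)] with ω hω
    rw [hω]; rfl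
  have hI : ∀ i j, Integrable
      (fun ω => c i * c j * ((|F i ω| + |F j ω| - |F i ω - F j ω|) / 2)) μ := fun i j =>
    ((((hint (F i)).add (hint (F j))).sub (hd i j)).div_const 2).const_mul _
  have h0 : 0 ≤ ∫ ω, ∑ i ∈ s, ∑ j ∈ s,
      c i * c j * ((|F i ω| + |F j ω| - |F i ω - F j ω|) / 2) ∂μ :=
    integral_nonneg fun ω => aux_scalar s c (fun i => F i ω)
  rw [integral_finsetSum _ (fun i _ => integrable_finsetSum _ fun j _ => hI i j)] at h0
  convert h0 using 1
  refine Finset.sum_congr rfl fun i _ => ?_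
  rw [integral_finsetSum _ (fun j _ => hI i j)]
  refine Finset.sum_congr rfl fun j _ => ?_
  have hadd : Integrable (fun ω => |F i ω| + |F j ω|) μ := (hint (F i)).add (hint (F j))
  rw [integral_const_mul, integral_div, integral_sub hadd (hd i j),
    integral_add (hint (F i)) (hint (F j)), hn, hn, hnd]

/-- `L₁` with the square root of its metric embeds isometrically into a Hilbert space. -/
theorem aux_embed {Ω : Type*} [MeasurableSpace Ω] (μ : Measure Ω) {ι : Type}
    (F : ι → Lp ℝ 1 μ) :
    ∃ (H : Type) (_ : NormedAddCommGroup H) (_ : InnerProductSpace ℝ H) (_ : CompleteSpace H)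
      (φ : ι → H), ∀ p q, inner ℝ (φ p) (φ q) = (‖F p‖ + ‖F q‖ - ‖F p - F q‖) / 2 := by
  let k : ι → ι → ℝ := fun p q => (‖F p‖ + ‖F q‖ - ‖F p - F q‖) / 2
  have hk : ∀ p q, k p q = k q p := fun p q => by
    simp only [k]; rw [norm_sub_rev, add_comm]
  let K : Matrix ι ι (ℝ →L[ℝ] ℝ) := Matrix.of fun p q => k p q • (1 : ℝ →L[ℝ] ℝ)
  have hK : K.PosSemidef := by
    have hiff := (RKHS.posSemidef_tfae (𝕜 := ℝ) (K := K)).out 0 2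
    refine hiff.mpr ⟨?_, fun vv => ?_⟩
    · ext p q
      simp [K, hk p q, Matrix.conjTranspose_apply]
    · have := aux_L1 μ F vv.support vv
      simp only [RCLike.re_to_real, Finsupp.sum]
      convert this using 1
      refine Finset.sum_congr rfl fun i _ => Finset.sum_congr rfl fun j _ => ?_
      change _ = vv i * vv j * k i j
      rw [hk i j]
      simp [K]
      ring
  have : Fact K.PosSemidef := ⟨hK⟩
  refine ⟨RKHS.OfKernel K, inferInstance, inferInstance, inferInstance,
    fun p => RKHS.kerFun (RKHS.OfKernel K) p (1 : ℝ), fun p q => ?_⟩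
  rw [← RKHS.kernel_inner, RKHS.OfKernel.kernel_ofKernel]
  change _ = k p q
  rw [hk p q]
  simp [K, hk]

/-- Example 6.5: every bilipschitz embedding of the space
`({u_i} ∪ {b_j}, exampleDist)` into `L₁` has distortion at least `3`. -/
theorem example_union_L1_distortion_ge_three
    (Ω : Type*) [MeasurableSpace Ω] (μ : Measure Ω)
    (F : ℕ ⊕ ℕ → Lp ℝ 1 μ) (C1 C2 : ℝ) (hC1 : 0 < C1) (hC2 : 0 < C2)
    (hF : ∀ p q, C1 * exampleDist p q ≤ ‖F p - F q‖ ∧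
                 ‖F p - F q‖ ≤ C2 * exampleDist p q) :
    3 ≤ C2 / C1 := by
  obtain ⟨H, _, _, _, φ, hφ⟩ := aux_embed μ F
  have hself : ∀ p, ‖φ p‖ ^ 2 = ‖F p‖ := fun p => by
    rw [← real_inner_self_eq_norm_sq, hφ]; simp
  have hdist : ∀ p q, ‖φ p - φ q‖ ^ 2 = ‖F p - F q‖ := fun p q => by
    rw [norm_sub_sq_real, hφ, hself, hself]; ring
  have hbd : ∀ p, ‖φ p‖ ≤ ‖F (Sum.inl 0)‖ + 3 * C2 + 1 := fun p => by
    have h1 : exampleDist p (Sum.inl 0) ≤ 3 := by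
      rcases p with i | j <;> simp only [exampleDist] <;> split_ifs <;> norm_num
    have h2 := (hF p (Sum.inl 0)).2
    have h3 : ‖F p‖ ≤ ‖F p - F (Sum.inl 0)‖ + ‖F (Sum.inl 0)‖ := by
      simpa using norm_add_le (F p - F (Sum.inl 0)) (F (Sum.inl 0))
    have h4 := hself p
    nlinarith [sq_nonneg (‖φ p‖ - 1), mul_le_mul_of_nonneg_left h1 hC2.le]
  have key := aux_stable (fun i => φ (Sum.inl i)) (fun j => φ (Sum.inr j)) _
    (fun i => hbd _) (fun j => hbd _) C2 (3 * C1)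
    (fun i j hij => by
      have := (hF (Sum.inl i) (Sum.inr j)).2
      rw [hdist]
      simpa [exampleDist, hij] using this)
    (fun i j hij => by
      have := (hF (Sum.inl i) (Sum.inr j)).1
      rw [hdist]
      simpa [exampleDist, not_le.2 hij, mul_comm] using this)
  rw [le_div_iff₀ hC1]
  exact key
end
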